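/- arXiv:2106.07683 — 3 statements merged into one kernel-verified Lean document; each statement's English description precedes it below -/
import Mathlib

section
/- Let X be a metrizable topological space, f : X → X continuous, 𝒳 a finite index set carrying a finite closed cover ξ ↦ |ξ| of X, and F : 𝒳 ⇉ 𝒳 an outer approximation of f. The recurrent dynamics of f is contained in the regions corresponding to recurrent components of F: if x ∈ X is a recurrent point of f, meaning there is a strictly increasing sequence n₁ < n₂ < … of positive integers with f^{n_k}(x) → x, and x lies in the interior of some cell |ξ|, then ξ belongs to a recurrent component of F (ξ lies on a directed cycle of F). -/
/-- Recurrent dynamics of `f` is contained in recurrent components of an outer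
approximation `F`: if `x` is a recurrent point of `f` lying in the interior of
some cell `|ξ|`, then `ξ` lies on a directed cycle of `F`. -/
theorem recurrent_point_in_recurrent_component
    {X : Type*} [TopologicalSpace X] [TopologicalSpace.MetrizableSpace X]
    (f : X → X) (hf : Continuous f)
    {ι : Type*} [Fintype ι] (cell : ι → Set X)
    (hclosed : ∀ ξ, IsClosed (cell ξ))
    (hcover : ⋃ ξ, cell ξ = Set.univ)
    (F : ι → Set ι)
    (houter : ∀ ξ ξ', (f '' cell ξ ∩ cell ξ').Nonempty → ξ' ∈ F ξ)
    (x : X) (n : ℕ → ℕ) (hmono : StrictMono n) (hpos : ∀ k, 1 ≤ n k)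
    (hrec : Filter.Tendsto (fun k => f^[n k] x) Filter.atTop (nhds x))
    (ξ : ι) (hx : x ∈ interior (cell ξ)) :
    ∃ (k : ℕ) (η : ℕ → ι), 1 ≤ k ∧ η 0 = ξ ∧ η k = ξ ∧
      ∀ i < k, η (i + 1) ∈ F (η i) := by
  obtain ⟨j, hj⟩ := (hrec.eventually (mem_interior_iff_mem_nhds.mp hx)).exists
  have hsel : ∀ y, ∃ ζ, y ∈ cell ζ ∧ (y ∈ cell ξ → ζ = ξ) := by
    intro y
    by_cases hy : y ∈ cell ξ
    · exact ⟨ξ, hy, fun _ => rfl⟩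
    · obtain ⟨ζ, hζ⟩ := Set.iUnion_eq_univ_iff.mp hcover y
      exact ⟨ζ, hζ, fun h => absurd h hy⟩
  choose g hg hgξ using hsel
  refine ⟨n j, fun i => g (f^[i] x), hpos j, hgξ _ (interior_subset hx), hgξ _ hj, ?_⟩
  intro i _
  refine houter _ _ ⟨f (f^[i] x), Set.mem_image_of_mem f (hg _), ?_⟩
  rw [← Function.iterate_succ_apply' f i x]
  exact hg _
end

section
/- Let (X, d) be a compact metric space, f : X → X continuous, 𝒳 a finite index set carrying a finite closed cover ξ ↦ |ξ| of X, ε > 0, and F : 𝒳 ⇉ 𝒳 a multivalued map satisfying the ε-fattened outer approximation condition: for every ξ, ξ' ∈ 𝒳, if there exist y ∈ |ξ| and z ∈ |ξ'| with d(f(y), z) < ε, then ξ' ∈ F(ξ). If x ∈ X admits an ε-chain from x to itself (points x = y₀, y₁, …, y_m = x with m ≥ 1 and d(f(yᵢ), yᵢ₊₁) < ε for all 0 ≤ i < m), then every cell ξ with x ∈ |ξ| lies on a directed cycle of F, i.e., belongs to a recurrent component of F. -/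
/-- If `F` is an `ε`-fattened outer approximation of `f` on a compact metric
space with a finite closed cover, and `x` admits an `ε`-chain from itself to
itself, then every cell containing `x` lies on a directed cycle of `F`. -/
theorem eps_chain_gives_recurrent_component
    {X : Type*} [MetricSpace X] [CompactSpace X]
    (f : X → X) (hf : Continuous f)
    {ι : Type*} [Fintype ι] (cell : ι → Set X)
    (hclosed : ∀ ξ, IsClosed (cell ξ))
    (hcover : ⋃ ξ, cell ξ = Set.univ)
    (ε : ℝ) (hε : 0 < ε)
    (F : ι → Set ι)
    (hfat : ∀ ξ ξ', (∃ y ∈ cell ξ, ∃ z ∈ cell ξ', dist (f y) z < ε) → ξ' ∈ F ξ)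
    (x : X) (m : ℕ) (hm : 1 ≤ m) (y : ℕ → X)
    (hy0 : y 0 = x) (hym : y m = x)
    (hchain : ∀ i < m, dist (f (y i)) (y (i + 1)) < ε) :
    ∀ ξ : ι, x ∈ cell ξ →
      ∃ (k : ℕ) (η : ℕ → ι), 1 ≤ k ∧ η 0 = ξ ∧ η k = ξ ∧
        ∀ i < k, η (i + 1) ∈ F (η i) := by
  classical
  intro ξ hξ
  have hmem : ∀ p : X, ∃ ξ', p ∈ cell ξ' := fun p =>
    Set.mem_iUnion.mp (hcover ▸ Set.mem_univ p)
  choose c hc using hmem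
  have hupdate : ∀ p, p ∈ cell (Function.update c x ξ p) := by
    intro p
    by_cases hp : p = x
    · subst hp
      simpa using hξ
    · simpa [Function.update_of_ne hp] using hc p
  exact ⟨m, fun i => Function.update c x ξ (y i), hm, by simp [hy0], by simp [hym],
    fun i hi => hfat _ _ ⟨y i, hupdate _, y (i + 1), hupdate _, hchain i hi⟩⟩
end

section
/- Let X be a topological space, f : X → X continuous, 𝒳 a finite index set carrying a finite cover of X by compact cells ξ ↦ |ξ|, and F : 𝒳 ⇉ 𝒳 an outer approximation of f that additionally satisfies the strict covering condition f(|ξ|) ⊆ int(⋃_{ξ'∈F(ξ)} |ξ'|) for every ξ ∈ 𝒳. Then for every nonempty S ⊆ 𝒳 forward invariant under F (F(ξ) ⊆ S for all ξ ∈ S), the realized region |S| = ⋃_{ξ∈S} |ξ| is an attracting block for f: |S| is compact and f(|S|) ⊆ int(|S|). -/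
/-- If an outer approximation `F` of `f` on a finite compact cover satisfies
the strict covering condition `f(|ξ|) ⊆ int(|F(ξ)|)`, then the realized region
of every nonempty forward-invariant set of cells is an attracting block. -/
theorem realized_region_attracting_block {X : Type*} [TopologicalSpace X]
    (f : X → X) (hf : Continuous f)
    {ι : Type*} [Fintype ι] (cell : ι → Set X)
    (hcompact : ∀ ξ, IsCompact (cell ξ))
    (hcover : ⋃ ξ, cell ξ = Set.univ)
    (F : ι → Set ι)
    (houter : ∀ ξ ξ', (f '' cell ξ ∩ cell ξ').Nonempty → ξ' ∈ F ξ)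
    (hstrict : ∀ ξ, f '' cell ξ ⊆ interior (⋃ ξ' ∈ F ξ, cell ξ'))
    (S : Set ι) (hSne : S.Nonempty) (hS : ∀ ξ ∈ S, F ξ ⊆ S) :
    IsCompact (⋃ ξ ∈ S, cell ξ) ∧
      f '' (⋃ ξ ∈ S, cell ξ) ⊆ interior (⋃ ξ ∈ S, cell ξ) := by
  refine ⟨S.toFinite.isCompact_biUnion fun ξ _ => hcompact ξ, ?_⟩
  rw [Set.image_iUnion₂]
  exact Set.iUnion₂_subset fun ξ hξ =>
    (hstrict ξ).trans (interior_mono (Set.biUnion_subset_biUnion_left (hS ξ hξ)))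
end
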